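/- Let G be a linear algebraic group acting algebraically on irreducible quasi-affine varieties X and Y, with a G-equivariant morphism p : X → Y. Let H ≤ G be a closed subgroup and W ⊆ X an H-invariant subvariety. Assume G acts transitively on Y, fix y₀ ∈ Y with stabilizer G₀, set X₀ = p⁻¹(y₀) and W₀ = W ∩ X₀, and assume X₀ is irreducible and W = H·W₀. Then G·W = G·W₀, and G·W is dense in X if and only if G₀·W₀ is dense in X₀. -/

import Mathlib

noncomputable section

open MvPolynomial

/-- The Zariski topology on affine `k`-space over `ℂ`. -/
def zariski (k : ℕ) : TopologicalSpace (Fin k → ℂ) :=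
  TopologicalSpace.generateFrom
    {s | ∃ f : MvPolynomial (Fin k) ℂ, s = {x | MvPolynomial.eval x f ≠ 0}}

/-- The coordinates of a matrix, as a point of affine space. -/
def matCoords {N : ℕ} (M : Matrix (Fin N) (Fin N) ℂ) : Fin N × Fin N → ℂ :=
  fun p => M p.1 p.2

/-- The (algebraic) action map determined by a family of polynomials in the matrix
entries and the point coordinates. -/
def polyAct {N k : ℕ} (P : Fin k → MvPolynomial ((Fin N × Fin N) ⊕ Fin k) ℂ)
    (M : Matrix (Fin N) (Fin N) ℂ) (x : Fin k → ℂ) : Fin k → ℂ :=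
  fun i => MvPolynomial.eval (Sum.elim (matCoords M) x) (P i)

/-- `f` vanishes on the subgroup `G` of `GL_N(ℂ)`. -/
def vanishesOn {N : ℕ} (G : Subgroup (Matrix.GeneralLinearGroup (Fin N) ℂ))
    (f : MvPolynomial (Fin N × Fin N) ℂ) : Prop :=
  ∀ g ∈ G, MvPolynomial.eval (matCoords (g : Matrix (Fin N) (Fin N) ℂ)) f = 0

/-- `G` is Zariski closed in `GL_N(ℂ)`. -/
def IsZariskiClosedSubgroup {N : ℕ}
    (G : Subgroup (Matrix.GeneralLinearGroup (Fin N) ℂ)) : Prop :=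
  ∀ M : Matrix.GeneralLinearGroup (Fin N) ℂ,
    (∀ f : MvPolynomial (Fin N × Fin N) ℂ, vanishesOn G f →
      MvPolynomial.eval (matCoords (M : Matrix (Fin N) (Fin N) ℂ)) f = 0) → M ∈ G

theorem zariski_basis (k : ℕ) : @TopologicalSpace.IsTopologicalBasis _ (zariski k)
    {s | ∃ f : MvPolynomial (Fin k) ℂ, s = {x | MvPolynomial.eval x f ≠ 0}} := by
  letI := zariski k
  refine ⟨?_, ?_, rfl⟩
  · rintro _ ⟨f, rfl⟩ _ ⟨g, rfl⟩ x ⟨hf, hg⟩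
    refine ⟨_, ⟨f * g, rfl⟩, ?_, ?_⟩
    · simp only [Set.mem_setOf_eq, map_mul] at *
      exact mul_ne_zero hf hg
    · intro y hy
      simp only [Set.mem_setOf_eq, map_mul] at hy
      exact ⟨left_ne_zero_of_mul hy, right_ne_zero_of_mul hy⟩
  · refine Set.eq_univ_of_forall fun x => ⟨_, ⟨1, rfl⟩, ?_⟩
    simp

theorem zariski_isOpen {k : ℕ} (f : MvPolynomial (Fin k) ℂ) :
    @IsOpen _ (zariski k) {x | MvPolynomial.eval x f ≠ 0} :=
  TopologicalSpace.isOpen_generateFrom_of_mem ⟨f, rfl⟩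

theorem zariski_mem_closure {k : ℕ} (S : Set (Fin k → ℂ)) (x : Fin k → ℂ) :
    x ∈ @closure _ (zariski k) S ↔
      ∀ f : MvPolynomial (Fin k) ℂ, (∀ y ∈ S, eval y f = 0) → eval x f = 0 := by
  letI := zariski k
  rw [(zariski_basis k).mem_closure_iff]
  constructor
  · intro h f hf
    by_contra hx
    obtain ⟨y, hy, hyS⟩ := h _ ⟨f, rfl⟩ hx
    exact hy (hf y hyS)
  · rintro h _ ⟨f, rfl⟩ hx
    by_contra hne
    refine hx (h f fun y hy => ?_)
    by_contra hy0
    exact hne ⟨y, hy0, hy⟩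

theorem zariski_irred {k : ℕ} {S : Set (Fin k → ℂ)} (hS : @IsIrreducible _ (zariski k) S)
    (f g : MvPolynomial (Fin k) ℂ) (h : ∀ x ∈ S, eval x (f * g) = 0) :
    (∀ x ∈ S, eval x f = 0) ∨ (∀ x ∈ S, eval x g = 0) := by
  letI := zariski k
  by_contra! hcon
  obtain ⟨⟨x, hx, hxf⟩, ⟨y, hy, hyg⟩⟩ := hcon
  obtain ⟨z, hz, hz1, hz2⟩ :=
    hS.2 _ _ (zariski_isOpen f) (zariski_isOpen g) ⟨x, hx, hxf⟩ ⟨y, hy, hyg⟩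
  have := h z hz
  rw [map_mul] at this
  exact mul_ne_zero hz1 hz2 this

theorem zariski_locClosed {k : ℕ} {S : Set (Fin k → ℂ)}
    (hS : @IsLocallyClosed _ (zariski k) S) {x₁ : Fin k → ℂ} (hx₁ : x₁ ∈ S) :
    ∃ h : MvPolynomial (Fin k) ℂ, eval x₁ h ≠ 0 ∧ ∀ x, eval x h ≠ 0 →
      (∀ f : MvPolynomial (Fin k) ℂ, (∀ y ∈ S, eval y f = 0) → eval x f = 0) → x ∈ S := by
  letI := zariski k
  obtain ⟨U, Z, hU, hZ, rfl⟩ := hS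
  obtain ⟨_, ⟨h, rfl⟩, hx, hsub⟩ := (zariski_basis k).exists_subset_of_mem_open hx₁.1 hU
  refine ⟨h, hx, fun x hxh hxf => ⟨hsub hxh, ?_⟩⟩
  have : x ∈ closure (U ∩ Z) := (zariski_mem_closure _ _).2 hxf
  exact closure_minimal Set.inter_subset_right hZ this

/-- A constructible set in a spectrum contains, or avoids, a neighbourhood of the generic point
of any irreducible closed set. -/
theorem constructible_generic {R : Type*} [CommRing R] {C : Set (PrimeSpectrum R)}
    (hC : Topology.IsConstructible C) (P : PrimeSpectrum R) :
    ∃ r : R, r ∉ P.asIdeal ∧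
      ((∀ Q : PrimeSpectrum R, P.asIdeal ≤ Q.asIdeal → r ∉ Q.asIdeal → Q ∈ C) ∨
       (∀ Q : PrimeSpectrum R, P.asIdeal ≤ Q.asIdeal → r ∉ Q.asIdeal → Q ∉ C)) := by
  induction hC using Topology.IsConstructible.empty_union_induction with
  | open_retrocompact U hU _ =>
    by_cases hP : P ∈ U
    · obtain ⟨_, ⟨r, rfl⟩, hr, hsub⟩ :=
        PrimeSpectrum.isTopologicalBasis_basic_opens.exists_subset_of_mem_open hP hU
      exact ⟨r, hr, Or.inl fun Q _ hQ => hsub hQ⟩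
    · refine ⟨1, fun h => P.2.ne_top ((Ideal.eq_top_iff_one _).2 h), Or.inr fun Q hPQ _ hQ => hP ?_⟩
      have : P ⤳ Q := (PrimeSpectrum.le_iff_specializes P Q).1 hPQ
      exact this.mem_open hU hQ
  | union s hs t ht ihs iht =>
    obtain ⟨r, hr, h1⟩ := ihs
    obtain ⟨r', hr', h2⟩ := iht
    have key : ∀ Q : PrimeSpectrum R, r * r' ∉ Q.asIdeal → r ∉ Q.asIdeal ∧ r' ∉ Q.asIdeal :=
      fun Q hQ => ⟨fun h => hQ (Q.asIdeal.mul_mem_right _ h), fun h => hQ (Q.asIdeal.mul_mem_left _ h)⟩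
    refine ⟨r * r', fun h => (P.2.mem_or_mem h).elim hr hr', ?_⟩
    rcases h1 with h1 | h1
    · exact Or.inl fun Q hPQ hQ => Or.inl (h1 Q hPQ (key Q hQ).1)
    rcases h2 with h2 | h2
    · exact Or.inl fun Q hPQ hQ => Or.inr (h2 Q hPQ (key Q hQ).2)
    · exact Or.inr fun Q hPQ hQ h => h.elim (h1 Q hPQ (key Q hQ).1) (h2 Q hPQ (key Q hQ).2)
  | compl s hs ih =>
    obtain ⟨r, hr, h | h⟩ := ih
    · exact ⟨r, hr, Or.inr fun Q h1 h2 h3 => h3 (h Q h1 h2)⟩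
    · exact ⟨r, hr, Or.inl fun Q h1 h2 => h Q h1 h2⟩

/-- Chevalley on closed points: a dense image of a locally closed set contains an open set. -/
theorem chevalley_points {σ : Type} [Finite σ] {a : ℕ}
    (q : Fin a → MvPolynomial σ ℂ) (E : Set (MvPolynomial σ ℂ)) (s : MvPolynomial σ ℂ)
    (X : Set (Fin a → ℂ)) (hX : @IsIrreducible _ (zariski a) X)
    (hsub : ∀ z : σ → ℂ, (∀ f ∈ E, eval z f = 0) → eval z s ≠ 0 → (fun i => eval z (q i)) ∈ X)
    (hdense : ∀ r : MvPolynomial (Fin a) ℂ,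
      (∀ z : σ → ℂ, (∀ f ∈ E, eval z f = 0) → eval z s ≠ 0 →
        eval (fun i => eval z (q i)) r = 0) → ∀ x ∈ X, eval x r = 0) :
    ∃ r : MvPolynomial (Fin a) ℂ, (∃ x ∈ X, eval x r ≠ 0) ∧
      ∀ x ∈ X, eval x r ≠ 0 → ∃ z : σ → ℂ,
        (∀ f ∈ E, eval z f = 0) ∧ eval z s ≠ 0 ∧ (fun i => eval z (q i)) = x := by
  have hmemV : ∀ r : MvPolynomial (Fin a) ℂ, r ∈ vanishingIdeal ℂ X ↔ ∀ x ∈ X, eval x r = 0 := by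
    intro r; simp [mem_vanishingIdeal_iff, aeval_eq_eval]
  have hprime : (vanishingIdeal ℂ X).IsPrime := by
    constructor
    · intro h
      obtain ⟨x, hx⟩ := hX.1
      have := (hmemV 1).1 (h ▸ Submodule.mem_top) x hx
      simp at this
    · intro f g hfg
      simp only [hmemV] at *
      exact zariski_irred hX f g hfg
  let P : PrimeSpectrum (MvPolynomial (Fin a) ℂ) := ⟨_, hprime⟩
  let φ : MvPolynomial (Fin a) ℂ →+* MvPolynomial σ ℂ := (aeval q : _ →ₐ[ℂ] _).toRingHom
  have hφ : ∀ z r, eval z (φ r) = eval (fun i => eval z (q i)) r := by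
    intro z r
    change eval z (aeval q r) = _
    induction r using MvPolynomial.induction_on with
    | C c => simp
    | add p q hp hq => rw [map_add, map_add, map_add, hp, hq]
    | mul_X p i hp => rw [map_mul, map_mul, map_mul, hp, aeval_X, eval_X]
  have hfp : φ.FinitePresentation := by
    refine RingHom.FinitePresentation.of_comp_finiteType
      (algebraMap ℂ (MvPolynomial (Fin a) ℂ)) ?_ ?_
    · have : φ.comp (algebraMap ℂ (MvPolynomial (Fin a) ℂ)) = algebraMap ℂ (MvPolynomial σ ℂ) :=
        (aeval q : MvPolynomial (Fin a) ℂ →ₐ[ℂ] _).comp_algebraMap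
      rw [this, RingHom.finitePresentation_algebraMap]
      infer_instance
    · rw [RingHom.finiteType_algebraMap]
      infer_instance
  let T : Set (PrimeSpectrum (MvPolynomial σ ℂ)) :=
    PrimeSpectrum.zeroLocus E ∩ (PrimeSpectrum.basicOpen s : Set _)
  have hT : Topology.IsConstructible T := by
    refine Topology.IsConstructible.inter ?_ ?_
    · rw [← Topology.isConstructible_compl]
      exact (TopologicalSpace.NoetherianSpace.isCompact _).isConstructible
        (PrimeSpectrum.isClosed_zeroLocus E).isOpen_compl
    · exact (TopologicalSpace.NoetherianSpace.isCompact _).isConstructible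
        (PrimeSpectrum.basicOpen s).2
  have hC := PrimeSpectrum.isConstructible_comap_image hfp hT
  have hpt : ∀ {τ : Type} (z : τ → ℂ) (f : MvPolynomial τ ℂ),
      f ∈ (pointToPoint (k := ℂ) z).asIdeal ↔ eval z f = 0 := by
    intro τ z f
    change f ∈ vanishingIdeal ℂ {z} ↔ _
    rw [mem_vanishingIdeal_singleton_iff, aeval_eq_eval]
  have hPpt : ∀ x ∈ X, P.asIdeal ≤ (pointToPoint (k := ℂ) x).asIdeal :=
    fun x hx f hf => (hpt x f).2 ((hmemV f).1 hf x hx)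
  obtain ⟨r, hr, h⟩ := constructible_generic hC P
  have hrX : ∃ x ∈ X, eval x r ≠ 0 := by
    by_contra! hcon
    exact hr ((hmemV r).2 hcon)
  refine ⟨r, hrX, ?_⟩
  rcases h with h | h
  · intro x hx hxr
    obtain ⟨Q, ⟨hQE, hQs⟩, hQ⟩ := h (pointToPoint x) (hPpt x hx) (fun h => hxr ((hpt x r).1 h))
    have hs : s ∉ vanishingIdeal ℂ (zeroLocus ℂ Q.asIdeal) := by
      rw [IsPrime.vanishingIdeal_zeroLocus]
      exact hQs
    rw [mem_vanishingIdeal_iff] at hs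
    push Not at hs
    obtain ⟨z, hz, hzs⟩ := hs
    refine ⟨z, fun f hf => hz f (hQE hf), hzs, ?_⟩
    funext i
    have h1 : (MvPolynomial.X i - C (x i) : MvPolynomial (Fin a) ℂ) ∈ (pointToPoint (k := ℂ) x).asIdeal :=
      (hpt _ _).2 (by simp)
    rw [← hQ] at h1
    have h2 : eval z (φ (MvPolynomial.X i - C (x i))) = 0 := hz _ h1
    rw [hφ] at h2
    simpa [sub_eq_zero] using h2
  · exfalso
    obtain ⟨x, hx, hxr⟩ := hrX
    refine hxr (hdense r ?_ x hx)
    intro z hz hzs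
    by_contra hzr
    refine h (pointToPoint (fun i => eval z (q i))) (hPpt _ (hsub z hz hzs))
      (fun h => hzr ((hpt _ _).1 h)) ⟨pointToPoint z, ⟨?_, ?_⟩, ?_⟩
    · intro f hf
      exact (hpt _ _).2 (hz f hf)
    · exact fun h => hzs ((hpt _ _).1 h)
    · ext f
      rw [hpt, ← hφ, ← hpt z]
      rfl

theorem polyAct_pull {N k : ℕ} (P : Fin k → MvPolynomial ((Fin N × Fin N) ⊕ Fin k) ℂ)
    (M : Matrix (Fin N) (Fin N) ℂ) (r : MvPolynomial (Fin k) ℂ) :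
    ∃ r' : MvPolynomial (Fin k) ℂ, ∀ x, eval x r' = eval (polyAct P M x) r := by
  refine ⟨bind₁ (fun i => bind₁ (Sum.elim (fun p => C (matCoords M p)) X) (P i)) r, fun x => ?_⟩
  have h1 : ∀ {τ υ : Type} (u : τ → MvPolynomial υ ℂ) (y : υ → ℂ) (f : MvPolynomial τ ℂ),
      eval y (bind₁ u f) = eval (fun i => eval y (u i)) f := by
    intro τ υ u y f
    induction f using MvPolynomial.induction_on with
    | C c => simp
    | add p q hp hq => simp [hp, hq]
    | mul_X p i hp => simp [hp]
  rw [h1]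
  congr 2
  funext i
  rw [h1, polyAct]
  congr 2
  funext j
  rcases j with j | j <;> simp

/-- Let a linear algebraic group `G` act algebraically on irreducible quasi-affine
varieties `X ⊆ ℂ^a`, `Y ⊆ ℂ^b`, with a `G`-equivariant morphism `p : X → Y`; let `H ≤ G`
be a closed subgroup, `W ⊆ X` an `H`-invariant subvariety, assume `G` acts transitively
on `Y`, fix `y₀ ∈ Y` with stabilizer `G₀`, set `X₀ = p⁻¹(y₀)`, `W₀ = W ∩ X₀`, and assume
`X₀` irreducible and `W = H·W₀`.  Then `G·W = G·W₀`, and `G·W` is dense in `X` iff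
`G₀·W₀` is dense in `X₀`. -/
theorem stmt3 {N aDim bDim : ℕ}
    (G : Subgroup (Matrix.GeneralLinearGroup (Fin N) ℂ)) (hGc : IsZariskiClosedSubgroup G)
    (X : Set (Fin aDim → ℂ)) (Y : Set (Fin bDim → ℂ))
    (hXlc : @IsLocallyClosed _ (zariski aDim) X) (hYlc : @IsLocallyClosed _ (zariski bDim) Y)
    (hXirr : @IsIrreducible _ (zariski aDim) X) (hYirr : @IsIrreducible _ (zariski bDim) Y)
    (PX : Fin aDim → MvPolynomial ((Fin N × Fin N) ⊕ Fin aDim) ℂ)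
    (PY : Fin bDim → MvPolynomial ((Fin N × Fin N) ⊕ Fin bDim) ℂ)
    -- the polynomial maps restrict to group actions of `G` on `X` and on `Y`
    (hactX : ∀ g ∈ G, ∀ x ∈ X, polyAct PX (g : Matrix (Fin N) (Fin N) ℂ) x ∈ X)
    (hactX1 : ∀ x ∈ X, polyAct PX (1 : Matrix (Fin N) (Fin N) ℂ) x = x)
    (hactXmul : ∀ g ∈ G, ∀ h ∈ G, ∀ x ∈ X,
      polyAct PX ((g * h : Matrix.GeneralLinearGroup (Fin N) ℂ) :
          Matrix (Fin N) (Fin N) ℂ) x =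
        polyAct PX (g : Matrix (Fin N) (Fin N) ℂ)
          (polyAct PX (h : Matrix (Fin N) (Fin N) ℂ) x))
    (hactY : ∀ g ∈ G, ∀ y ∈ Y, polyAct PY (g : Matrix (Fin N) (Fin N) ℂ) y ∈ Y)
    (hactY1 : ∀ y ∈ Y, polyAct PY (1 : Matrix (Fin N) (Fin N) ℂ) y = y)
    (hactYmul : ∀ g ∈ G, ∀ h ∈ G, ∀ y ∈ Y,
      polyAct PY ((g * h : Matrix.GeneralLinearGroup (Fin N) ℂ) :
          Matrix (Fin N) (Fin N) ℂ) y =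
        polyAct PY (g : Matrix (Fin N) (Fin N) ℂ)
          (polyAct PY (h : Matrix (Fin N) (Fin N) ℂ) y))
    -- the morphism `p : X → Y`, given by polynomials, `G`-equivariant
    (Pp : Fin bDim → MvPolynomial (Fin aDim) ℂ)
    (hp : ∀ x ∈ X, (fun i => MvPolynomial.eval x (Pp i)) ∈ Y)
    (hequiv : ∀ g ∈ G, ∀ x ∈ X,
      (fun i => MvPolynomial.eval (polyAct PX (g : Matrix (Fin N) (Fin N) ℂ) x) (Pp i)) =
        polyAct PY (g : Matrix (Fin N) (Fin N) ℂ) (fun i => MvPolynomial.eval x (Pp i)))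
    -- `H` a closed subgroup of `G`, `W ⊆ X` an `H`-invariant subvariety
    (H : Subgroup (Matrix.GeneralLinearGroup (Fin N) ℂ)) (hHG : H ≤ G)
    (hHc : IsZariskiClosedSubgroup H)
    (W : Set (Fin aDim → ℂ)) (hWX : W ⊆ X) (hWlc : @IsLocallyClosed _ (zariski aDim) W)
    (hWH : ∀ h ∈ H, ∀ w ∈ W, polyAct PX (h : Matrix (Fin N) (Fin N) ℂ) w ∈ W)
    -- `G` acts transitively on `Y`, base point `y₀`
    (htrans : ∀ y₁ ∈ Y, ∀ y₂ ∈ Y, ∃ g ∈ G,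
      polyAct PY (g : Matrix (Fin N) (Fin N) ℂ) y₁ = y₂)
    (y₀ : Fin bDim → ℂ) (hy₀ : y₀ ∈ Y)
    -- `X₀ = p⁻¹(y₀)` is irreducible and `W = H·W₀` where `W₀ = W ∩ X₀`
    (hX₀irr : @IsIrreducible _ (zariski aDim)
      {x | x ∈ X ∧ (fun i => MvPolynomial.eval x (Pp i)) = y₀})
    (hW : W = {x | ∃ h ∈ H, ∃ w, (w ∈ W ∧ (w ∈ X ∧
        (fun i => MvPolynomial.eval w (Pp i)) = y₀)) ∧
      polyAct PX ((h : Matrix.GeneralLinearGroup (Fin N) ℂ) :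
          Matrix (Fin N) (Fin N) ℂ) w = x}) :
    -- conclusion: `G·W = G·W₀`, and density equivalence
    ({x | ∃ g ∈ G, ∃ w ∈ W, polyAct PX (g : Matrix (Fin N) (Fin N) ℂ) w = x} =
      {x | ∃ g ∈ G, ∃ w, (w ∈ W ∧ (w ∈ X ∧
          (fun i => MvPolynomial.eval w (Pp i)) = y₀)) ∧
        polyAct PX (g : Matrix (Fin N) (Fin N) ℂ) w = x}) ∧
    ((X ⊆ @closure _ (zariski aDim)
        {x | ∃ g ∈ G, ∃ w ∈ W, polyAct PX (g : Matrix (Fin N) (Fin N) ℂ) w = x}) ↔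
      ({x | x ∈ X ∧ (fun i => MvPolynomial.eval x (Pp i)) = y₀} ⊆
        @closure _ (zariski aDim)
          {x | ∃ g ∈ G, (g ∈ G ∧ polyAct PY (g : Matrix (Fin N) (Fin N) ℂ) y₀ = y₀) ∧
            ∃ w, (w ∈ W ∧ (w ∈ X ∧ (fun i => MvPolynomial.eval w (Pp i)) = y₀)) ∧
              polyAct PX (g : Matrix (Fin N) (Fin N) ℂ) w = x})) := by
  have hinvG : ∀ g ∈ G, ∀ x ∈ X, polyAct PX ((g⁻¹ : Matrix.GeneralLinearGroup (Fin N) ℂ) :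
      Matrix (Fin N) (Fin N) ℂ) (polyAct PX (g : Matrix (Fin N) (Fin N) ℂ) x) = x := by
    intro g hg x hx
    rw [← hactXmul _ (G.inv_mem hg) _ hg x hx, inv_mul_cancel]
    exact hactX1 x hx
  have hinvY : ∀ g ∈ G, ∀ x ∈ Y, polyAct PY ((g⁻¹ : Matrix.GeneralLinearGroup (Fin N) ℂ) :
      Matrix (Fin N) (Fin N) ℂ) (polyAct PY (g : Matrix (Fin N) (Fin N) ℂ) x) = x := by
    intro g hg x hx
    rw [← hactYmul _ (G.inv_mem hg) _ hg x hx, inv_mul_cancel]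
    exact hactY1 x hx
  have hfirst : {x | ∃ g ∈ G, ∃ w ∈ W, polyAct PX (g : Matrix (Fin N) (Fin N) ℂ) w = x} =
      {x | ∃ g ∈ G, ∃ w, (w ∈ W ∧ (w ∈ X ∧
          (fun i => MvPolynomial.eval w (Pp i)) = y₀)) ∧
        polyAct PX (g : Matrix (Fin N) (Fin N) ℂ) w = x} := by
    ext x
    constructor
    · rintro ⟨g, hg, w, hw, rfl⟩
      rw [hW] at hw
      obtain ⟨h, hh, w, hw, rfl⟩ := hw
      exact ⟨g * h, G.mul_mem hg (hHG hh), w, hw, hactXmul g hg h (hHG hh) w hw.2.1⟩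
    · rintro ⟨g, hg, w, hw, rfl⟩
      exact ⟨g, hg, w, hw.1, rfl⟩
  -- every point of `X` is a translate of a point of the fibre
  have hXtrans : ∀ x ∈ X, ∃ g ∈ G, ∃ x₀ ∈ X, (fun i => MvPolynomial.eval x₀ (Pp i)) = y₀ ∧
      polyAct PX (g : Matrix (Fin N) (Fin N) ℂ) x₀ = x := by
    intro x hx
    obtain ⟨g, hg, hgy⟩ := htrans _ (hp x hx) _ hy₀
    exact ⟨g⁻¹, G.inv_mem hg, _, hactX g hg x hx, by rw [hequiv g hg x hx, hgy],
      hinvG g hg x hx⟩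
  refine ⟨hfirst, ?_, ?_⟩
  · rw [hfirst]
    intro hd x₁ hx₁
    rw [zariski_mem_closure]
    intro f hf
    by_contra hfx
    obtain ⟨h, hhx, hh⟩ := zariski_locClosed hXlc hx₁.1
    let incG : MvPolynomial (Fin N × Fin N) ℂ → MvPolynomial ((Fin N × Fin N) ⊕ Fin aDim) ℂ :=
      rename Sum.inl
    let incX : MvPolynomial (Fin aDim) ℂ → MvPolynomial ((Fin N × Fin N) ⊕ Fin aDim) ℂ :=
      rename Sum.inr
    have hincG : ∀ z e, eval z (incG e) = eval (fun i => z (Sum.inl i)) e := by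
      intro z e; simp only [incG, eval_rename]; rfl
    have hincX : ∀ z e, eval z (incX e) = eval (fun i => z (Sum.inr i)) e := by
      intro z e; simp only [incX, eval_rename]; rfl
    obtain ⟨d, hd'⟩ : ∃ d : MvPolynomial (Fin N × Fin N) ℂ,
        ∀ z, eval z d = (Matrix.of fun i j => z (i, j)).det := by
      refine ⟨(Matrix.of fun i j => (MvPolynomial.X (i, j) : MvPolynomial (Fin N × Fin N) ℂ)).det,
        fun z => ?_⟩
      rw [RingHom.map_det]
      congr 1
      ext i j
      simp
    let E : Set (MvPolynomial ((Fin N × Fin N) ⊕ Fin aDim) ℂ) :=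
      {e | (∃ e', vanishesOn G e' ∧ e = incG e') ∨
        (∃ e', (∀ x ∈ X, eval x e' = 0) ∧ e = incX e') ∨
        (∃ i, e = incX (Pp i - C (y₀ i)))}
    let s := incG d * incX (h * f)
    -- the locally closed set is `G × V`
    have hTmem : ∀ z : (Fin N × Fin N) ⊕ Fin aDim → ℂ, (∀ e ∈ E, eval z e = 0) → eval z s ≠ 0 →
        ∃ g ∈ G, ∃ v ∈ X, (fun i => MvPolynomial.eval v (Pp i)) = y₀ ∧ eval v f ≠ 0 ∧
          (fun i => eval z (PX i)) = polyAct PX (g : Matrix (Fin N) (Fin N) ℂ) v := by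
      intro z hzE hzs
      simp only [s, map_mul, hincG] at hzs
      rw [hincX, map_mul, hd'] at hzs
      have hdet := left_ne_zero_of_mul hzs
      have hhf := right_ne_zero_of_mul hzs
      let g := Matrix.GeneralLinearGroup.mkOfDetNeZero _ hdet
      have hgc : matCoords (g : Matrix (Fin N) (Fin N) ℂ) = fun i => z (Sum.inl i) := rfl
      refine ⟨g, hGc g ?_, fun i => z (Sum.inr i), hh _ (left_ne_zero_of_mul hhf) ?_, ?_,
        right_ne_zero_of_mul hhf, ?_⟩
      · intro e he
        rw [hgc, ← hincG]
        exact hzE _ (Or.inl ⟨e, he, rfl⟩)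
      · intro e he
        rw [← hincX]
        exact hzE _ (Or.inr (Or.inl ⟨e, he, rfl⟩))
      · funext i
        have := hzE _ (Or.inr (Or.inr ⟨i, rfl⟩))
        rw [hincX] at this
        simpa [sub_eq_zero] using this
      · funext i
        rw [polyAct, hgc]
        congr 2
        funext j
        rcases j with j | j <;> rfl
    have hTmem' : ∀ g ∈ G, ∀ v ∈ X, (fun i => MvPolynomial.eval v (Pp i)) = y₀ →
        eval v h ≠ 0 → eval v f ≠ 0 →
        (∀ e ∈ E, eval (Sum.elim (matCoords (g : Matrix (Fin N) (Fin N) ℂ)) v) e = 0) ∧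
          eval (Sum.elim (matCoords (g : Matrix (Fin N) (Fin N) ℂ)) v) s ≠ 0 := by
      intro g hg v hv hpv hvh hvf
      constructor
      · rintro e (⟨e', he', rfl⟩ | ⟨e', he', rfl⟩ | ⟨i, rfl⟩)
        · rw [hincG]; exact he' g hg
        · rw [hincX]; exact he' v hv
        · rw [hincX]
          have := congrFun hpv i
          simpa [sub_eq_zero] using this
      · simp only [s, map_mul (eval _) (incG d), hincG, hincX, hd']
        refine mul_ne_zero ?_ ?_
        · exact ((Matrix.isUnit_iff_isUnit_det _).1 g.isUnit).ne_zero
        · rw [map_mul]; exact mul_ne_zero hvh hvf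
    obtain ⟨r, ⟨x, hx, hxr⟩, hr⟩ := chevalley_points PX E s X hXirr
      (by
        intro z h1 h2
        obtain ⟨g, hg, v, hv, -, -, h3⟩ := hTmem z h1 h2
        rw [h3]
        exact hactX g hg v hv)
      (by
        intro r hr x hx
        obtain ⟨g, hg, x₀, hx₀, hpx₀, rfl⟩ := hXtrans x hx
        obtain ⟨r', hr'⟩ := polyAct_pull PX (g : Matrix (Fin N) (Fin N) ℂ) r
        rw [← hr']
        have := zariski_irred hX₀irr r' (h * f) (by
          rintro v ⟨hv, hpv⟩
          by_contra hne
          rw [map_mul, map_mul] at hne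
          have hhf := right_ne_zero_of_mul hne
          obtain ⟨h1, h2⟩ := hTmem' g hg v hv hpv (left_ne_zero_of_mul hhf)
            (right_ne_zero_of_mul hhf)
          apply left_ne_zero_of_mul hne
          rw [hr']
          exact hr _ h1 h2)
        rcases this with h1 | h1
        · exact h1 x₀ ⟨hx₀, hpx₀⟩
        · have := h1 x₁ hx₁
          rw [map_mul] at this
          exact absurd this (mul_ne_zero hhx hfx))
    refine hxr ((zariski_mem_closure _ _).1 (hd hx) r ?_)
    rintro _ ⟨g', hg', w, hw, rfl⟩
    by_contra hne
    obtain ⟨z, h1, h2, h3⟩ := hr _ (hactX g' hg' w hw.2.1) hne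
    obtain ⟨g, hg, v, hv, hpv, hvf, h4⟩ := hTmem z h1 h2
    rw [h3] at h4
    -- `g' w = g v`, so `v = g⁻¹ g' w` lies in `G₀ W₀`
    have hv' : polyAct PX ((g⁻¹ * g' : Matrix.GeneralLinearGroup (Fin N) ℂ) :
        Matrix (Fin N) (Fin N) ℂ) w = v := by
      rw [hactXmul _ (G.inv_mem hg) _ hg' w hw.2.1, h4, hinvG g hg v hv]
    have hm := G.mul_mem (G.inv_mem hg) hg'
    refine hvf (hf v ⟨g⁻¹ * g', hm, ⟨hm, ?_⟩, w, hw, hv'⟩)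
    have := hequiv _ hm w hw.2.1
    rw [hv', hpv, hw.2.2] at this
    exact this.symm
  · intro hd x hx
    rw [zariski_mem_closure]
    intro f hf
    obtain ⟨g, hg, x₀, hx₀, hpx₀, rfl⟩ := hXtrans x hx
    obtain ⟨r', hr'⟩ := polyAct_pull PX (g : Matrix (Fin N) (Fin N) ℂ) f
    rw [← hr']
    refine (zariski_mem_closure _ _).1 (hd ⟨hx₀, hpx₀⟩) r' ?_
    rintro _ ⟨g', hg', -, w, hw, rfl⟩
    rw [hr', ← hactXmul g hg g' hg' w hw.2.1]
    exact hf _ ⟨g * g', G.mul_mem hg hg', w, hw.1, rfl⟩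

end
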